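/- Every bowtie-free graph G admits a partition of its vertex set into at most ⌈(ω(G) + 3·binom(ω(G),3))/2⌉ + 1 sets such that one set induces a K_4-free graph and all other sets induce triangle-free graphs. -/

import Mathlib

/-- The bowtie: two triangles sharing one vertex. -/
def bowtie : SimpleGraph (Fin 5) :=
  SimpleGraph.fromRel (fun a b => a = 0 ∨ (a = 1 ∧ b = 2) ∨ (a = 3 ∧ b = 4))

open Classical in
/-- Neighbours of `u` inside `K`. -/
noncomputable def nbrIn {V : Type*} (G : SimpleGraph V) (K : Finset V) (u : V) : Finset V :=
  K.filter (fun k => G.Adj u k)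

lemma mem_nbrIn {V : Type*} {G : SimpleGraph V} {K : Finset V} {u k : V} :
    k ∈ nbrIn G K u ↔ k ∈ K ∧ G.Adj u k := by
  classical
  simp [nbrIn]

lemma nbrIn_subset {V : Type*} (G : SimpleGraph V) (K : Finset V) (u : V) :
    nbrIn G K u ⊆ K := by
  classical
  simp [nbrIn]

/-- The bowtie-free property, spelled out on vertices. -/
def BtFree {V : Type*} (G : SimpleGraph V) : Prop :=
  ∀ x a b c d, G.Adj x a → G.Adj x b → G.Adj x c → G.Adj x d → G.Adj a b → G.Adj c d →
    ¬ G.Adj a c → ¬ G.Adj a d → ¬ G.Adj b c → ¬ G.Adj b d → False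

lemma btFree_of {V : Type*} (G : SimpleGraph V) (hfree : ¬ Nonempty (bowtie ↪g G)) :
    BtFree G := by
  intro x a b c d hxa hxb hxc hxd hab hcd hac had hbc hbd
  apply hfree
  have nac : a ≠ c := by rintro rfl; exact hbc hab.symm
  have nad : a ≠ d := by rintro rfl; exact hbd hab.symm
  have nbc : b ≠ c := by rintro rfl; exact hac hab
  have nbd : b ≠ d := by rintro rfl; exact had hab
  have h1 := hxa.ne
  have h2 := hxb.ne
  have h3 := hxc.ne
  have h4 := hxd.ne
  have h5 := hab.ne
  have h6 := hcd.ne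
  refine ⟨⟨⟨![x, a, b, c, d], ?_⟩, ?_⟩⟩
  · intro i j hij
    fin_cases i <;> fin_cases j <;> simp_all
  · intro i j
    have s1 := hxa.symm
    have s2 := hxb.symm
    have s3 := hxc.symm
    have s4 := hxd.symm
    have s5 := hab.symm
    have s6 := hcd.symm
    have t1 : ¬ G.Adj c a := fun h => hac h.symm
    have t2 : ¬ G.Adj d a := fun h => had h.symm
    have t3 : ¬ G.Adj c b := fun h => hbc h.symm
    have t4 : ¬ G.Adj d b := fun h => hbd h.symm
    change G.Adj (![x, a, b, c, d] i) (![x, a, b, c, d] j) ↔ bowtie.Adj i j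
    clear hfree
    fin_cases i <;> fin_cases j <;> simp_all [bowtie]

section steps

variable {V : Type*} {G : SimpleGraph V}

/-- An edge of `u, v` with disjoint neighbourhoods in `K` has no common neighbour with at most one
neighbour in `K`. -/
lemma disjoint_pair (hb : BtFree G) {K : Finset V} (hK : G.IsClique (K : Set V))
    (hc : 4 ≤ K.card) {u v w : V} (huv : G.Adj u v) (huw : G.Adj u w) (hvw : G.Adj v w)
    (hd : ∀ k ∈ K, G.Adj u k → G.Adj v k → False)
    (hu : 2 ≤ (nbrIn G K u).card) (hw : (nbrIn G K w).card ≤ 1) : False := by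
  classical
  have hw' := Finset.card_le_one.1 hw
  by_cases h3 : 3 ≤ (nbrIn G K u).card
  · have h1 := Finset.le_card_sdiff (nbrIn G K w) (nbrIn G K u)
    obtain ⟨a, ha, a', ha', hne⟩ :=
      Finset.one_lt_card.1 (show 1 < (nbrIn G K u \ nbrIn G K w).card by omega)
    simp only [Finset.mem_sdiff, mem_nbrIn, not_and] at ha ha'
    exact hb u a a' v w ha.1.2 ha'.1.2 huv huw (hK ha.1.1 ha'.1.1 hne) hvw
      (fun h => hd a ha.1.1 ha.1.2 h.symm) (fun h => ha.2 ha.1.1 h.symm)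
      (fun h => hd a' ha'.1.1 ha'.1.2 h.symm) (fun h => ha'.2 ha'.1.1 h.symm)
  · have h1 := Finset.le_card_sdiff (nbrIn G K u) K
    obtain ⟨b, hbb, b', hbb', hne⟩ :=
      Finset.one_lt_card.1 (show 1 < (K \ nbrIn G K u).card by omega)
    obtain ⟨a, ha, a', ha', hne'⟩ := Finset.one_lt_card.1 (show 1 < (nbrIn G K u).card by omega)
    simp only [Finset.mem_sdiff, mem_nbrIn, not_and] at hbb hbb' ha ha'
    have key : ∀ k ∈ K, G.Adj u k → ¬ G.Adj w k := by
      intro k hk huk hwk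
      have n1 : k ≠ b := by rintro rfl; exact hbb.2 hk huk
      have n2 : k ≠ b' := by rintro rfl; exact hbb'.2 hk huk
      exact hb k u w b b' huk.symm hwk.symm (hK hk hbb.1 n1) (hK hk hbb'.1 n2) huw
        (hK hbb.1 hbb'.1 hne) (hbb.2 hbb.1) (hbb'.2 hbb'.1)
        (fun h => n1 (hw' k (mem_nbrIn.2 ⟨hk, hwk⟩) b (mem_nbrIn.2 ⟨hbb.1, h⟩)))
        (fun h => n2 (hw' k (mem_nbrIn.2 ⟨hk, hwk⟩) b' (mem_nbrIn.2 ⟨hbb'.1, h⟩)))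
    exact hb u a a' v w ha.2 ha'.2 huv huw (hK ha.1 ha'.1 hne') hvw
      (fun h => hd a ha.1 ha.2 h.symm) (fun h => key a ha.1 ha.2 h.symm)
      (fun h => hd a' ha'.1 ha'.2 h.symm) (fun h => key a' ha'.1 ha'.2 h.symm)

/-- If `u` misses at least two vertices of `K`, then a neighbour of `u` with at most one
neighbour in `K` shares no neighbour in `K` with `u`. -/
lemma no_hit (hb : BtFree G) {K : Finset V} (hK : G.IsClique (K : Set V))
    {u v : V} (huv : G.Adj u v) (hu : 2 + (nbrIn G K u).card ≤ K.card)
    (hv : (nbrIn G K v).card ≤ 1) : ∀ k ∈ K, G.Adj u k → ¬ G.Adj v k := by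
  classical
  have hv' := Finset.card_le_one.1 hv
  have h1 := Finset.le_card_sdiff (nbrIn G K u) K
  obtain ⟨b, hbb, b', hbb', hne⟩ :=
    Finset.one_lt_card.1 (show 1 < (K \ nbrIn G K u).card by omega)
  simp only [Finset.mem_sdiff, mem_nbrIn, not_and] at hbb hbb'
  intro k hk huk hwk
  have n1 : k ≠ b := by rintro rfl; exact hbb.2 hk huk
  have n2 : k ≠ b' := by rintro rfl; exact hbb'.2 hk huk
  exact hb k u v b b' huk.symm hwk.symm (hK hk hbb.1 n1) (hK hk hbb'.1 n2) huv
    (hK hbb.1 hbb'.1 hne) (hbb.2 hbb.1) (hbb'.2 hbb'.1)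
    (fun h => n1 (hv' k (mem_nbrIn.2 ⟨hk, hwk⟩) b (mem_nbrIn.2 ⟨hbb.1, h⟩)))
    (fun h => n2 (hv' k (mem_nbrIn.2 ⟨hk, hwk⟩) b' (mem_nbrIn.2 ⟨hbb'.1, h⟩)))

/-- A triangle `u, v, w` where `v, w` avoid the neighbours of `u` in `K`. -/
lemma avoid_tri (hb : BtFree G) {K : Finset V} (hK : G.IsClique (K : Set V))
    {u v w : V} (huv : G.Adj u v) (huw : G.Adj u w) (hvw : G.Adj v w)
    (hu : 2 ≤ (nbrIn G K u).card)
    (hv : ∀ k ∈ K, G.Adj u k → ¬ G.Adj v k) (hw : ∀ k ∈ K, G.Adj u k → ¬ G.Adj w k) :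
    False := by
  obtain ⟨a, ha, a', ha', hne'⟩ := Finset.one_lt_card.1 (show 1 < (nbrIn G K u).card by omega)
  simp only [mem_nbrIn] at ha ha'
  exact hb u a a' v w ha.2 ha'.2 huv huw (hK ha.1 ha'.1 hne') hvw
    (fun h => hv a ha.1 ha.2 h.symm) (fun h => hw a ha.1 ha.2 h.symm)
    (fun h => hv a' ha'.1 ha'.2 h.symm) (fun h => hw a' ha'.1 ha'.2 h.symm)

lemma exists_index {α : Type*} (T : Finset α) :
    ∃ g : α → ℕ, (∀ x ∈ T, g x < T.card) ∧ ∀ x ∈ T, ∀ y ∈ T, g x = g y → x = y := by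
  classical
  refine ⟨fun x => if h : x ∈ T then (T.equivFin ⟨x, h⟩ : ℕ) else 0, ?_, ?_⟩
  · intro x hx
    simp [hx]
  · intro x hx y hy h
    simp only [hx, hy, dif_pos] at h
    have := T.equivFin.injective (Fin.ext h)
    exact congrArg Subtype.val this

/-- One step of the decomposition. -/
def Step (G : SimpleGraph V) (S : Finset V) (B : ℕ) : Prop :=
  ∃ M : Set V, (∃ x ∈ M, x ∈ S) ∧ ∃ f : V → ℕ,
    (∀ u ∈ S, u ∈ M → 1 ≤ f u ∧ f u ≤ B) ∧
    (∀ u ∈ S, u ∈ M → ∀ v ∈ S, v ∉ M → ∀ w ∈ S, w ∉ M →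
      G.Adj u v → G.Adj u w → G.Adj v w → False) ∧
    (∀ u ∈ S, u ∈ M → ∀ v ∈ S, v ∈ M → ∀ w ∈ S, w ∉ M →
      G.Adj u v → G.Adj u w → G.Adj v w → f u = f v → False) ∧
    (∀ u ∈ S, u ∈ M → ∀ v ∈ S, v ∈ M → ∀ w ∈ S, w ∈ M →
      G.Adj u v → G.Adj u w → G.Adj v w → f u = f v → f u = f w → False)

lemma nbrIn_of_mem [DecidableEq V] {K : Finset V} (hK : G.IsClique (K : Set V)) {x : V}
    (hx : x ∈ K) : nbrIn G K x = K.erase x := by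
  ext k
  simp only [mem_nbrIn, Finset.mem_erase]
  constructor
  · rintro ⟨h1, h2⟩
    exact ⟨h2.ne', h1⟩
  · rintro ⟨h1, h2⟩
    exact ⟨h2, hK hx h2 h1.symm⟩

lemma nbrIn_card_lt {S K : Finset V} (hKS : K ⊆ S) (hK : G.IsClique (K : Set V))
    (hmax : ∀ s ⊆ S, G.IsClique (s : Set V) → s.card ≤ K.card) {u : V} (hu : u ∈ S) :
    (nbrIn G K u).card < K.card := by
  classical
  refine lt_of_le_of_ne (Finset.card_le_card (nbrIn_subset G K u)) fun h => ?_
  have h' := Finset.eq_of_subset_of_card_le (nbrIn_subset G K u) h.ge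
  have hall : ∀ k ∈ K, G.Adj u k := fun k hk => (mem_nbrIn.1 (h' ▸ hk)).2
  have hn : u ∉ K := fun hk => (hall u hk).ne rfl
  have := hmax (insert u K) (Finset.insert_subset hu hKS) (by
    rw [Finset.coe_insert]
    exact hK.insert fun b hb _ => hall b hb)
  rw [Finset.card_insert_of_notMem hn] at this
  omega

/-- Two vertices with a common missed vertex and complete to the rest are nonadjacent. -/
lemma miss_one {S K : Finset V} (hKS : K ⊆ S) (hK : G.IsClique (K : Set V))
    (hmax : ∀ s ⊆ S, G.IsClique (s : Set V) → s.card ≤ K.card) {u v b : V} (hu : u ∈ S)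
    (hv : v ∈ S) (hbK : b ∈ K) (hua : ∀ k ∈ K, k ≠ b → G.Adj u k)
    (hva : ∀ k ∈ K, k ≠ b → G.Adj v k) (huv : G.Adj u v) : False := by
  classical
  have h1 : v ∉ K.erase b := fun h =>
    (hva v (Finset.mem_of_mem_erase h) (Finset.ne_of_mem_erase h)).ne rfl
  have h2 : u ∉ insert v (K.erase b) := by
    rw [Finset.mem_insert]
    rintro (h | h)
    · exact huv.ne h
    · exact (hua u (Finset.mem_of_mem_erase h) (Finset.ne_of_mem_erase h)).ne rfl
  have := hmax (insert u (insert v (K.erase b)))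
    (Finset.insert_subset hu (Finset.insert_subset hv ((Finset.erase_subset _ _).trans hKS))) (by
      rw [Finset.coe_insert, Finset.coe_insert]
      refine (SimpleGraph.IsClique.insert (hK.subset ?_) ?_).insert ?_
      · exact_mod_cast Finset.erase_subset b K
      · intro k hk _
        have hk := Finset.mem_coe.1 hk
        exact hva k (Finset.mem_of_mem_erase hk) (Finset.ne_of_mem_erase hk)
      · intro k hk _
        rcases hk with rfl | hk
        · exact huv
        · have hk := Finset.mem_coe.1 hk
          exact hua k (Finset.mem_of_mem_erase hk) (Finset.ne_of_mem_erase hk))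
  rw [Finset.card_insert_of_notMem h2, Finset.card_insert_of_notMem h1,
    Finset.card_erase_of_mem hbK] at this
  have := Finset.card_pos.2 ⟨b, hbK⟩
  omega

/-- The step for a maximum clique with at least five vertices. -/
lemma step_large (hb : BtFree G) {S K : Finset V} (hKS : K ⊆ S) (hK : G.IsClique (K : Set V))
    (hc : 5 ≤ K.card) (hmax : ∀ s ⊆ S, G.IsClique (s : Set V) → s.card ≤ K.card) {B : ℕ}
    (hB : (K.card + 1).choose 2 ≤ B) : Step G S B := by
  classical
  have hex : ∀ u, ∃ z : Sym2 V, u ∈ S → z ∈ K.sym2 ∧ (∀ b ∈ z, ¬ G.Adj u b) ∧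
      (z.IsDiag → ∀ k ∈ K, k ∉ z → G.Adj u k) := by
    intro u
    by_cases hu : u ∈ S
    swap
    · exact ⟨s(u, u), fun h => (hu h).elim⟩
    have h1 := nbrIn_card_lt hKS hK hmax hu
    have h2 := Finset.card_sdiff_add_card_eq_card (nbrIn_subset G K u)
    by_cases h3 : 1 < (K \ nbrIn G K u).card
    · obtain ⟨b, hbb, b', hbb', hne⟩ := Finset.one_lt_card.1 h3
      simp only [Finset.mem_sdiff, mem_nbrIn, not_and] at hbb hbb'
      refine ⟨s(b, b'), fun _ => ⟨by simp [hbb.1, hbb'.1], ?_, ?_⟩⟩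
      · intro x hx
        rcases Sym2.mem_iff.1 hx with rfl | rfl
        · exact hbb.2 hbb.1
        · exact hbb'.2 hbb'.1
      · intro h
        exact (hne (by simpa using h)).elim
    · obtain ⟨b, hbe⟩ := Finset.card_eq_one.1 (show (K \ nbrIn G K u).card = 1 by omega)
      have hm : ∀ k, (k ∈ K ∧ (k ∈ K → ¬ G.Adj u k)) ↔ k = b := by
        intro k
        have := Finset.ext_iff.1 hbe k
        simpa [mem_nbrIn] using this
      have hb0 := (hm b).2 rfl
      refine ⟨s(b, b), fun _ => ⟨by simp [hb0.1], ?_, ?_⟩⟩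
      · intro x hx
        rcases Sym2.mem_iff.1 hx with rfl | rfl <;> exact hb0.2 hb0.1
      · intro _ k hk hkz
        by_contra hn
        exact hkz (by rw [(hm k).1 ⟨hk, fun _ => hn⟩]; simp)
  choose z hz using hex
  obtain ⟨g, hg1, hg2⟩ := exists_index K.sym2
  rw [Finset.card_sym2] at hg1
  have hdis : ∀ u ∈ S, ∀ v ∈ S, G.Adj u v → g (z u) + 1 = g (z v) + 1 →
      ∀ k ∈ K, G.Adj u k → ¬ G.Adj v k := by
    intro u hu v hv huv hf k hk huk hvk
    have he := hg2 _ (hz u hu).1 _ (hz v hv).1 (by omega)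
    obtain ⟨hzK, hu1, hu2⟩ := hz u hu
    obtain ⟨-, hv1, hv2⟩ := hz v hv
    rw [← he] at hv1 hv2
    revert hzK hu1 hu2 hv1 hv2
    induction z u with
    | _ b b' =>
      intro hzK hu1 hu2 hv1 hv2
      simp only [Finset.mk_mem_sym2_iff] at hzK
      by_cases hbb : b = b'
      · subst hbb
        refine miss_one hKS hK hmax hu hv hzK.1 (fun k hk hne => hu2 (by simp) k hk (by simpa))
          (fun k hk hne => hv2 (by simp) k hk (by simpa)) huv
      · have a1 := hu1 b (by simp)
        have a2 := hu1 b' (by simp)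
        have a3 := hv1 b (by simp)
        have a4 := hv1 b' (by simp)
        have n1 : k ≠ b := by rintro rfl; exact a1 huk
        have n2 : k ≠ b' := by rintro rfl; exact a2 huk
        exact hb k u v b b' huk.symm hvk.symm (hK hk hzK.1 n1) (hK hk hzK.2 n2) huv
          (hK hzK.1 hzK.2 hbb) a1 a2 a3 a4
  refine ⟨{u | 2 ≤ (nbrIn G K u).card}, ?_, fun u => g (z u) + 1, ?_, ?_, ?_, ?_⟩
  · obtain ⟨x, hx⟩ := Finset.card_pos.1 (show 0 < K.card by omega)
    refine ⟨x, ?_, hKS hx⟩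
    rw [Set.mem_ofPred_eq, nbrIn_of_mem hK hx, Finset.card_erase_of_mem hx]
    omega
  · intro u hu _
    have := hg1 _ (hz u hu).1
    constructor <;> dsimp only <;> omega
  · intro u hu huM v hv hvM w hw hwM huv huw hvw
    simp only [Set.mem_ofPred_eq, not_le] at huM hvM hwM
    by_cases h : 2 + (nbrIn G K u).card ≤ K.card
    · exact avoid_tri hb hK huv huw hvw huM (no_hit hb hK huv h (by omega))
        (no_hit hb hK huw h (by omega))
    · have h1 := Finset.le_card_sdiff (nbrIn G K v) (nbrIn G K u)
      have h2 := Finset.le_card_sdiff (nbrIn G K w) (nbrIn G K u \ nbrIn G K v)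
      obtain ⟨a, ha, a', ha', hne⟩ := Finset.one_lt_card.1
        (show 1 < ((nbrIn G K u \ nbrIn G K v) \ nbrIn G K w).card by omega)
      simp only [Finset.mem_sdiff, mem_nbrIn, not_and] at ha ha'
      obtain ⟨⟨⟨ha0, ha1⟩, ha2⟩, ha3⟩ := ha
      obtain ⟨⟨⟨hb0, hb1⟩, hb2⟩, hb3⟩ := ha'
      exact hb u a a' v w ha1 hb1 huv huw (hK ha0 hb0 hne) hvw
        (fun h => ha2 ha0 h.symm) (fun h => ha3 ha0 h.symm)
        (fun h => hb2 hb0 h.symm) (fun h => hb3 hb0 h.symm)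
  · intro u hu huM v hv hvM w hw hwM huv huw hvw hf
    simp only [Set.mem_ofPred_eq, not_le] at huM hvM hwM
    exact disjoint_pair hb hK (by omega) huv huw hvw (hdis u hu v hv huv hf) huM (by omega)
  · intro u hu huM v hv hvM w hw hwM huv huw hvw hf hf'
    exact avoid_tri hb hK huv huw hvw huM (hdis u hu v hv huv hf) (hdis u hu w hw huw hf')

/-- The step for a maximum clique with exactly four vertices. -/
lemma step_four (hb : BtFree G) {S K : Finset V} (hKS : K ⊆ S) (hK : G.IsClique (K : Set V))
    (hc : K.card = 4) (hmax : ∀ s ⊆ S, G.IsClique (s : Set V) → s.card ≤ K.card) {B : ℕ}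
    (hB : 7 ≤ B) : Step G S B := by
  classical
  obtain ⟨k0, hk0⟩ := Finset.card_pos.1 (show 0 < K.card by omega)
  obtain ⟨g, hg1, hg2⟩ := exists_index ((K.erase k0).powerset.erase ∅)
  have hT : ((K.erase k0).powerset.erase ∅).card = 7 := by
    rw [Finset.card_erase_of_mem (by simp), Finset.card_powerset, Finset.card_erase_of_mem hk0, hc]
    norm_num
  rw [hT] at hg1
  set C : V → Finset V := fun u => if k0 ∈ nbrIn G K u then K \ nbrIn G K u else nbrIn G K u
    with hC
  set Q : V → Prop := fun u => (nbrIn G K u).card = 1 ∧ ∃ e ∈ S, (nbrIn G K e).card = 3 ∧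
    G.Adj e u ∧ nbrIn G K u ⊆ nbrIn G K e with hQ
  have hlt : ∀ u ∈ S, (nbrIn G K u).card < 4 := fun u hu => hc ▸ nbrIn_card_lt hKS hK hmax hu
  have hsd : ∀ u, (K \ nbrIn G K u).card + (nbrIn G K u).card = 4 := fun u =>
    hc ▸ Finset.card_sdiff_add_card_eq_card (nbrIn_subset G K u)
  set M : Set V := {u | 2 ≤ (nbrIn G K u).card ∨ Q u} with hM
  have hpos : ∀ u ∈ M, 1 ≤ (nbrIn G K u).card := by
    rintro u (h | h)
    · omega
    · exact h.1.ge
  have hCT : ∀ u ∈ S, u ∈ M → C u ∈ (K.erase k0).powerset.erase ∅ := by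
    intro u hu huM
    have h1 := hlt u hu
    have h2 := hpos u huM
    have h3 := hsd u
    rw [Finset.mem_erase, Finset.mem_powerset]
    simp only [hC]
    split_ifs with h
    · constructor
      · rw [← Finset.card_pos.trans Finset.nonempty_iff_ne_empty]; omega
      · intro x hx
        rw [Finset.mem_sdiff] at hx
        rw [Finset.mem_erase]
        exact ⟨fun he => hx.2 (he ▸ h), hx.1⟩
    · constructor
      · rw [← Finset.card_pos.trans Finset.nonempty_iff_ne_empty]; omega
      · intro x hx
        rw [Finset.mem_erase]
        exact ⟨fun he => h (he ▸ hx), nbrIn_subset G K u hx⟩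
  have hcol : ∀ u ∈ S, u ∈ M → ∀ v ∈ S, v ∈ M → g (C u) + 1 = g (C v) + 1 →
      nbrIn G K u = nbrIn G K v ∨ nbrIn G K v = K \ nbrIn G K u := by
    intro u hu huM v hv hvM hf
    have he := hg2 _ (hCT u hu huM) _ (hCT v hv hvM) (by omega)
    have s1 := nbrIn_subset G K u
    have s2 := nbrIn_subset G K v
    simp only [hC] at he
    split_ifs at he with h1 h2 h2
    · left
      rw [← Finset.sdiff_sdiff_eq_self s1, he, Finset.sdiff_sdiff_eq_self s2]
    · right; exact he.symm
    · right
      rw [he, Finset.sdiff_sdiff_eq_self s2]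
    · left; exact he
  have hsame : ∀ u ∈ S, u ∈ M → ∀ v ∈ S, nbrIn G K u = nbrIn G K v → G.Adj u v → False := by
    intro u hu huM v hv he huv
    have h1 := hlt u hu
    have h2 := hpos u huM
    have h3 := hsd u
    have hiff : ∀ k ∈ K, (G.Adj u k ↔ G.Adj v k) := by
      intro k hk
      have := Finset.ext_iff.1 he k
      simpa [mem_nbrIn, hk] using this
    by_cases h4 : 1 < (K \ nbrIn G K u).card
    · obtain ⟨b, hbb, b', hbb', hne⟩ := Finset.one_lt_card.1 h4
      obtain ⟨k, hk⟩ := Finset.card_pos.1 h2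
      simp only [Finset.mem_sdiff, mem_nbrIn, not_and] at hbb hbb' hk
      obtain ⟨hk, huk⟩ := hk
      have a1 := hbb.2 hbb.1
      have a2 := hbb'.2 hbb'.1
      have n1 : k ≠ b := by rintro rfl; exact a1 huk
      have n2 : k ≠ b' := by rintro rfl; exact a2 huk
      exact hb k u v b b' huk.symm ((hiff k hk).1 huk).symm (hK hk hbb.1 n1) (hK hk hbb'.1 n2) huv
          (hK hbb.1 hbb'.1 hne) a1 a2 (fun h => a1 ((hiff b hbb.1).2 h))
          (fun h => a2 ((hiff b' hbb'.1).2 h))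
    · obtain ⟨b, hbe⟩ := Finset.card_eq_one.1 (show (K \ nbrIn G K u).card = 1 by omega)
      have hm : ∀ k, (k ∈ K ∧ (k ∈ K → ¬ G.Adj u k)) ↔ k = b := by
        intro k
        have := Finset.ext_iff.1 hbe k
        simpa [mem_nbrIn] using this
      have hua : ∀ k ∈ K, k ≠ b → G.Adj u k := by
        intro k hk hne
        by_contra hn
        exact hne ((hm k).1 ⟨hk, fun _ => hn⟩)
      exact miss_one hKS hK hmax hu hv ((hm b).2 rfl).1 hua
        (fun k hk hne => (hiff k hk).1 (hua k hk hne)) huv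
  -- vertices outside `M` adjacent to a vertex with three neighbours
  have hthree : ∀ u ∈ S, (nbrIn G K u).card = 3 → ∀ v, v ∉ M → G.Adj u v →
      ∀ k ∈ K, G.Adj u k → ¬ G.Adj v k := by
    intro u hu h3 v hvM huv k hk huk hvk
    simp only [hM, Set.mem_ofPred_eq, not_or, not_le] at hvM
    have hkm : k ∈ nbrIn G K v := mem_nbrIn.2 ⟨hk, hvk⟩
    have h1 : (nbrIn G K v).card = 1 := by
      have := Finset.card_pos.2 ⟨k, hkm⟩
      omega
    refine hvM.2 ⟨h1, u, hu, h3, huv, ?_⟩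
    intro x hx
    rw [Finset.card_le_one.1 h1.le x hx k hkm]
    exact mem_nbrIn.2 ⟨hk, huk⟩
  have hout : ∀ v, v ∉ M → (nbrIn G K v).card ≤ 1 := by
    intro v hvM
    simp only [hM, Set.mem_ofPred_eq, not_or, not_le] at hvM
    omega
  refine ⟨M, ?_, fun u => g (C u) + 1, ?_, ?_, ?_, ?_⟩
  · refine ⟨k0, ?_, hKS hk0⟩
    left
    rw [nbrIn_of_mem hK hk0, Finset.card_erase_of_mem hk0]
    omega
  · intro u hu huM
    have := hg1 _ (hCT u hu huM)
    constructor <;> dsimp only <;> omega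
  · intro u hu huM v hv hvM w hw hwM huv huw hvw
    have hv1 := hout v hvM
    have hw1 := hout w hwM
    rcases huM with hu2 | ⟨hu1, e, heS, he3, heu, hsub⟩
    · by_cases h3 : (nbrIn G K u).card = 3
      · exact avoid_tri hb hK huv huw hvw hu2 (hthree u hu h3 v hvM huv) (hthree u hu h3 w hwM huw)
      · have := hlt u hu
        exact avoid_tri hb hK huv huw hvw hu2 (no_hit hb hK huv (by omega) hv1)
          (no_hit hb hK huw (by omega) hw1)
    · obtain ⟨a, hae⟩ := Finset.card_eq_one.1 hu1
      have ham : a ∈ nbrIn G K u := by rw [hae]; simp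
      have hae' := mem_nbrIn.1 (hsub ham)
      have ha := mem_nbrIn.1 ham
      have huniq : ∀ k ∈ K, k ≠ a → ¬ G.Adj u k := by
        intro k hk hne h
        have : k ∈ nbrIn G K u := mem_nbrIn.2 ⟨hk, h⟩
        rw [hae] at this
        exact hne (by simpa using this)
      have key : ∀ x, x ∉ M → G.Adj u x → ¬ G.Adj e x := by
        intro x hx hux hex
        have hav := hthree e heS he3 x hx hex
        obtain ⟨c, hcc, c', hcc', hne⟩ := Finset.one_lt_card.1
          (show 1 < ((nbrIn G K e).erase a).card by
            rw [Finset.card_erase_of_mem (hsub ham)]; omega)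
        simp only [Finset.mem_erase, mem_nbrIn] at hcc hcc'
        exact hb e u x c c' heu hex hcc.2.2 hcc'.2.2 hux (hK hcc.2.1 hcc'.2.1 hne)
          (huniq c hcc.2.1 hcc.1) (huniq c' hcc'.2.1 hcc'.1)
          (hav c hcc.2.1 hcc.2.2) (hav c' hcc'.2.1 hcc'.2.2)
      have n1 := no_hit hb hK huv (by omega) hv1 a ha.1 ha.2
      have n2 := no_hit hb hK huw (by omega) hw1 a ha.1 ha.2
      exact hb u a e v w ha.2 heu.symm huv huw hae'.2.symm hvw (fun h => n1 h.symm)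
        (fun h => n2 h.symm) (key v hvM huv) (key w hwM huw)
  · intro u hu huM v hv hvM w hw hwM huv huw hvw hf
    rcases hcol u hu huM v hv hvM hf with h | h
    · exact hsame u hu huM v hv h huv
    · have hd : ∀ k ∈ K, G.Adj u k → ¬ G.Adj v k := by
        intro k hk huk hvk
        have : k ∈ nbrIn G K v := mem_nbrIn.2 ⟨hk, hvk⟩
        rw [h, Finset.mem_sdiff] at this
        exact this.2 (mem_nbrIn.2 ⟨hk, huk⟩)
      have h3 := hsd u
      rw [← h] at h3
      by_cases h2 : 2 ≤ (nbrIn G K u).card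
      · exact disjoint_pair hb hK hc.ge huv huw hvw hd h2 (hout w hwM)
      · exact disjoint_pair hb hK hc.ge huv.symm hvw huw (fun k hk h1 h2 => hd k hk h2 h1)
          (by omega) (hout w hwM)
  · intro u hu huM v hv hvM w hw hwM huv huw hvw hf hf'
    rcases hcol u hu huM v hv hvM hf with h | h
    · exact hsame u hu huM v hv h huv
    · rcases hcol u hu huM w hw hwM hf' with h' | h'
      · exact hsame u hu huM w hw h' huw
      · exact hsame v hv hvM w hw (h.trans h'.symm) hvw

/-- Iterating the steps. -/
lemma iterate_steps {B : ℕ}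
    (hstep : ∀ S : Finset V, (∃ s ⊆ S, G.IsNClique 4 s) → Step G S B) :
    ∀ (n : ℕ) (S : Finset V), S.card = n → ∃ c : V → ℕ, (∀ v, c v ≤ B) ∧
      (∀ s ⊆ S, (∀ v ∈ s, c v = 0) → ¬ G.IsNClique 4 s) ∧
      (∀ u ∈ S, ∀ v ∈ S, ∀ w ∈ S, G.Adj u v → G.Adj u w → G.Adj v w → c u ≠ 0 →
        c u = c v → c u = c w → False) := by
  classical
  intro n
  induction n using Nat.strong_induction_on with
  | _ n ih =>
  intro S hS
  by_cases h4 : ∃ s ⊆ S, G.IsNClique 4 s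
  swap
  · refine ⟨fun _ => 0, fun _ => Nat.zero_le _, fun s hs _ h => h4 ⟨s, hs, h⟩, ?_⟩
    intro u _ v _ w _ _ _ _ h
    exact (h rfl).elim
  obtain ⟨M, ⟨x, hxM, hxS⟩, f, hf, h1, h2, h3⟩ := hstep S h4
  have hss : S.filter (fun v => v ∉ M) ⊂ S :=
    Finset.filter_ssubset.2 ⟨x, hxS, fun h => h hxM⟩
  obtain ⟨c, hc0, hc1, hc2⟩ := ih _ (hS ▸ Finset.card_lt_card hss) _ rfl
  have hmem : ∀ v ∈ S, v ∉ M → v ∈ S.filter (fun v => v ∉ M) := fun v hv hm =>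
    Finset.mem_filter.2 ⟨hv, hm⟩
  set c' : V → ℕ := fun v => if v ∈ S ∧ v ∈ M then f v else c v with hc'
  have e1 : ∀ v ∈ S, v ∈ M → c' v = f v := fun v hv hm => by simp [hc', hv, hm]
  have e2 : ∀ v, v ∉ M → c' v = c v := fun v hm => by simp [hc', hm]
  refine ⟨c', ?_, ?_, ?_⟩
  · intro v
    simp only [hc']
    split_ifs with h
    · exact (hf v h.1 h.2).2
    · exact hc0 v
  · intro s hs hz
    have hsM : ∀ v ∈ s, v ∉ M := by
      intro v hv hm
      have := hz v hv
      rw [e1 v (hs hv) hm] at this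
      have := (hf v (hs hv) hm).1
      omega
    exact hc1 s (fun v hv => hmem v (hs hv) (hsM v hv))
      (fun v hv => (e2 v (hsM v hv)) ▸ hz v hv)
  · intro u hu v hv w hw huv huw hvw hne huv' huw'
    by_cases hum : u ∈ M <;> by_cases hvm : v ∈ M <;> by_cases hwm : w ∈ M
    · rw [e1 u hu hum, e1 v hv hvm] at huv'
      rw [e1 u hu hum, e1 w hw hwm] at huw'
      exact h3 u hu hum v hv hvm w hw hwm huv huw hvw huv' huw'
    · rw [e1 u hu hum, e1 v hv hvm] at huv'
      exact h2 u hu hum v hv hvm w hw hwm huv huw hvw huv'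
    · rw [e1 u hu hum, e1 w hw hwm] at huw'
      exact h2 u hu hum w hw hwm v hv hvm huw huv hvw.symm huw'
    · exact h1 u hu hum v hv hvm w hw hwm huv huw hvw
    · have : c' v = c' w := huv'.symm.trans huw'
      rw [e1 v hv hvm, e1 w hw hwm] at this
      exact h2 v hv hvm w hw hwm u hu hum hvw huv.symm huw.symm this
    · exact h1 v hv hvm u hu hum w hw hwm huv.symm hvw huw
    · exact h1 w hw hwm u hu hum v hv hvm huw.symm hvw.symm huv
    · rw [e2 u hum, e2 v hvm] at huv'
      rw [e2 u hum, e2 w hwm] at huw'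
      rw [e2 u hum] at hne
      exact hc2 u (hmem u hu hum) v (hmem v hv hvm) w (hmem w hw hwm) huv huw hvw hne huv' huw'

end steps

lemma bound_seven {m : ℕ} (h : 4 ≤ m) : 7 ≤ (m + 3 * m.choose 3 + 1) / 2 := by
  have h1 : Nat.choose 4 3 ≤ m.choose 3 := Nat.choose_le_choose 3 h
  have h2 : Nat.choose 4 3 = 4 := by decide
  omega

lemma bound_large {m : ℕ} (h : 5 ≤ m) : (m + 1).choose 2 ≤ (m + 3 * m.choose 3 + 1) / 2 := by
  obtain ⟨k, rfl⟩ := Nat.exists_eq_add_of_le h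
  have key : 2 * (5 + k + 1).choose 2 ≤ 5 + k + 3 * (5 + k).choose 3 := by
    induction k with
    | zero => decide
    | succ k ih =>
      have ih := ih (by omega)
      have e1 : (5 + (k + 1) + 1).choose 2 = (5 + k + 1).choose 2 + (5 + k + 1) := by
        rw [show 5 + (k + 1) + 1 = (5 + k + 1) + 1 by ring, Nat.choose_succ_succ']
        simp
        omega
      have e2 : (5 + (k + 1)).choose 3 = (5 + k).choose 2 + (5 + k).choose 3 := by
        rw [show 5 + (k + 1) = (5 + k) + 1 by ring, Nat.choose_succ_succ']
      have e3 : (5 + k).choose 2 = (4 + k).choose 1 + (4 + k).choose 2 := by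
        rw [show 5 + k = (4 + k) + 1 by ring, Nat.choose_succ_succ']
      have e4 : Nat.choose 4 2 ≤ (4 + k).choose 2 := Nat.choose_le_choose 2 (by omega)
      have e5 : Nat.choose 4 2 = 6 := by decide
      rw [Nat.choose_one_right] at e3
      omega
  omega

/-- Every bowtie-free graph `G` admits a partition of its vertex set into at most
`⌈(ω(G) + 3·C(ω(G),3))/2⌉ + 1` sets (here colors `0, …, ⌈…⌉`), such that the set of
color `0` induces a `K_4`-free graph and every other color class induces a
triangle-free graph. -/
theorem bowtie_free_partition {V : Type*} [Fintype V] (G : SimpleGraph V)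
    (hfree : ¬ Nonempty (bowtie ↪g G)) :
    ∃ c : V → ℕ,
      (∀ v, c v < (G.cliqueNum + 3 * G.cliqueNum.choose 3 + 1) / 2 + 1) ∧
      (∀ s : Finset V, (s : Set V) ⊆ c ⁻¹' {0} → ¬ G.IsNClique 4 s) ∧
      (∀ i, i ≠ 0 → ∀ s : Finset V, (s : Set V) ⊆ c ⁻¹' {i} → ¬ G.IsNClique 3 s) := by
  classical
  have hb := btFree_of G hfree
  have hstep : ∀ S : Finset V, (∃ s ⊆ S, G.IsNClique 4 s) →
      Step G S ((G.cliqueNum + 3 * G.cliqueNum.choose 3 + 1) / 2) := by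
    rintro S ⟨s, hsS, hs⟩
    obtain ⟨K, hKm, hKmax⟩ := Finset.exists_max_image
      (S.powerset.filter fun t : Finset V => G.IsClique (t : Set V)) Finset.card
      ⟨s, Finset.mem_filter.2 ⟨Finset.mem_powerset.2 hsS, hs.isClique⟩⟩
    rw [Finset.mem_filter, Finset.mem_powerset] at hKm
    have hmax : ∀ t ⊆ S, G.IsClique (t : Set V) → t.card ≤ K.card := fun t ht hct =>
      hKmax t (Finset.mem_filter.2 ⟨Finset.mem_powerset.2 ht, hct⟩)
    have h4 : 4 ≤ K.card := hs.card_eq ▸ hmax s hsS hs.isClique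
    have hω : K.card ≤ G.cliqueNum := hKm.2.card_le_cliqueNum
    rcases h4.eq_or_lt with h | h
    · exact step_four hb hKm.1 hKm.2 h.symm hmax (bound_seven (by omega))
    · refine step_large hb hKm.1 hKm.2 h hmax ?_
      exact (Nat.choose_le_choose 2 (by omega)).trans (bound_large (show 5 ≤ G.cliqueNum by omega))
  obtain ⟨c, hc0, hc1, hc2⟩ := iterate_steps hstep _ Finset.univ rfl
  refine ⟨c, fun v => Nat.lt_succ_of_le (hc0 v), ?_, ?_⟩
  · intro s hs
    exact hc1 s (Finset.subset_univ s) fun v hv => hs hv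
  · intro i hi s hs h3
    obtain ⟨u, v, w, huv, huw, hvw, rfl⟩ := SimpleGraph.is3Clique_iff.1 h3
    have hu : c u = i := hs (by simp)
    have hv : c v = i := hs (by simp)
    have hw : c w = i := hs (by simp)
    exact hc2 u (Finset.mem_univ _) v (Finset.mem_univ _) w (Finset.mem_univ _) huv huw hvw
      (by omega) (by omega) (by omega)
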